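/- (Multisets with geometrically decaying ratios converge) Suppose ã_k^{(j)} = C(m_j+k−1, k)·p^{jk}, where the m_j are positive integers with m_j/m_{j+1} → ρ₀ as j → ∞ for some ρ₀ ∈ (0,1), and 0 < p < 1. Then (c̃_n)_{n≥0} ∈ RT_{ρ₀/p}, and for every l ≥ 1 and every (k_1,…,k_l) ∈ ℕ^l, lim_{n→∞} P_n(k_1,…,k_l) = ∏_{j=1}^l C(m_j+k_j−1, k_j)·ρ₀^{j·k_j}·(1−ρ₀^j)^{m_j}; in particular this multiset is convergent with independent negative-binomial limit laws. -/

import Mathlib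

open Finset Filter Topology

/-- The scaled partition function `c̃_n = ∑_{η ∈ Ω_n} ∏_{j=1}^n b_{k_j}^{(j)}` associated
with scaled weights `b j k = ã_k^{(j)}` (so `c̃_0 = 1`). -/
noncomputable def ctilOf (b : ℕ → ℕ → ℝ) (n : ℕ) : ℝ :=
  ∑ P : Nat.Partition n, ∏ j ∈ Finset.Icc 1 n, b j (Multiset.count j P.parts)

/-- The tail sums `T̃^{(l)}_m`: the sum over partitions of `m` with all parts `> l` of
`∏_{j=l+1}^m ã_{k_j}^{(j)}` (so `T̃^{(l)}_0 = 1`). -/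
noncomputable def TtilOf (b : ℕ → ℕ → ℝ) (l m : ℕ) : ℝ :=
  ∑ P : Nat.Partition m,
    if ∀ j ∈ P.parts, l < j
    then ∏ j ∈ Finset.Icc (l + 1) m, b j (Multiset.count j P.parts) else 0

/-- The marginal probability `P_n(k_1,…,k_l) = (∏_{j=1}^l ã_{k_j}^{(j)}) T̃^{(l)}_{n-M_l}/c̃_n`
where `M_l = ∑_{j=1}^l j k_j`. -/
noncomputable def PformOf (b : ℕ → ℕ → ℝ) (l : ℕ) (k : Fin l → ℕ) (n : ℕ) : ℝ :=
  (∏ i : Fin l, b ((i : ℕ) + 1) (k i))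
    * TtilOf b l (n - ∑ i : Fin l, ((i : ℕ) + 1) * k i) / ctilOf b n

/-- A sequence of nonnegative reals is in `RT_ρ` if `d_n/d_{n+1} → ρ`. -/
def RT (d : ℕ → ℝ) (ρ : ℝ) : Prop :=
  Tendsto (fun n => d n / d (n + 1)) atTop (nhds ρ)

/-- Scaled weights of a multiset: `ã_k^{(j)} = C(m_j+k−1, k) p^{jk}`
(negative-binomial case). -/
noncomputable def msWt (m : ℕ → ℕ) (p : ℝ) (j k : ℕ) : ℝ :=
  (Nat.choose (m j + k - 1) k : ℝ) * p ^ (j * k)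

/-- A nondecreasing positive sequence whose logarithmic-derivative coefficients have ratio
limit `ρ` has itself ratio limit `ρ`. -/
theorem tendsto_ratio_of_convolution {c g : ℕ → ℝ} {ρ : ℝ}
    (hc0 : ∀ n, 0 < c n) (hc : Monotone c) (hg0 : g 0 = 0) (hg : ∀ n, 0 < n → 0 < g n)
    (hlim : Tendsto (fun n => g n / g (n + 1)) atTop (𝓝 ρ))
    (hconv : ∀ n : ℕ, (n : ℝ) * c n = ∑ k ∈ range (n + 1), g k * c (n - k)) :
    Tendsto (fun n => c n / c (n + 1)) atTop (𝓝 ρ) := by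
  have key : Tendsto (fun n : ℕ => (n : ℝ) * c n / ((n + 1 : ℕ) * c (n + 1))) atTop (𝓝 ρ) := by
    rw [Metric.tendsto_atTop]
    intro ε hε
    obtain ⟨K, hK⟩ := (Metric.tendsto_atTop.1 hlim) (ε / 2) (by positivity)
    set A : ℝ := ∑ k ∈ range K, |g k - ρ * g (k + 1)| with hA
    have hA0 : 0 ≤ A := Finset.sum_nonneg fun _ _ => abs_nonneg _
    obtain ⟨N, hN⟩ := exists_nat_gt (A / (ε / 2))
    refine ⟨N, fun n hn => ?_⟩
    have hpos : 0 < ((n + 1 : ℕ) : ℝ) * c (n + 1) := mul_pos (by positivity) (hc0 _)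
    have hdiff : (n : ℝ) * c n - ρ * ((n + 1 : ℕ) * c (n + 1))
        = ∑ k ∈ range (n + 1), (g k - ρ * g (k + 1)) * c (n - k) := by
      rw [hconv n, hconv (n + 1), Finset.sum_range_succ' _ (n + 1), hg0, zero_mul, add_zero,
        Finset.mul_sum, ← Finset.sum_sub_distrib]
      refine Finset.sum_congr rfl fun k _ => ?_
      rw [Nat.add_sub_add_right]
      ring
    have hsum : ∑ k ∈ range (n + 1), g (k + 1) * c (n - k) = (n + 1 : ℕ) * c (n + 1) := by
      rw [hconv (n + 1), Finset.sum_range_succ' _ (n + 1), hg0, zero_mul, add_zero]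
      exact Finset.sum_congr rfl fun k _ => by rw [Nat.add_sub_add_right]
    have hterm : ∀ k ∈ range (n + 1), |(g k - ρ * g (k + 1)) * c (n - k)| ≤
        ε / 2 * (g (k + 1) * c (n - k)) +
          (if k < K then |g k - ρ * g (k + 1)| else 0) * c (n + 1) := by
      intro k _
      have h1 := hg (k + 1) (Nat.succ_pos k)
      have h2 := hc0 (n - k)
      have h3 : c (n - k) ≤ c (n + 1) := hc (by omega)
      rw [abs_mul, abs_of_pos h2]
      split_ifs with hk
      · have := mul_le_mul_of_nonneg_left h3 (abs_nonneg (g k - ρ * g (k + 1)))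
        have : 0 ≤ ε / 2 * (g (k + 1) * c (n - k)) := by positivity
        linarith
      · have h4 := (hK k (not_lt.1 hk)).le
        rw [Real.dist_eq, div_sub' h1.ne', abs_div, abs_of_pos h1, div_le_iff₀ h1,
          mul_comm (g (k + 1)) ρ] at h4
        have := mul_le_mul_of_nonneg_right h4 h2.le
        linarith
    have hif : ∑ k ∈ range (n + 1), (if k < K then |g k - ρ * g (k + 1)| else 0) ≤ A := by
      rw [← Finset.sum_filter]
      refine Finset.sum_le_sum_of_subset_of_nonneg (fun k hk => ?_) fun _ _ _ => abs_nonneg _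
      simp only [Finset.mem_filter] at hk
      exact Finset.mem_range.2 hk.2
    have hbound : |(n : ℝ) * c n - ρ * ((n + 1 : ℕ) * c (n + 1))|
        ≤ ε / 2 * ((n + 1 : ℕ) * c (n + 1)) + A * c (n + 1) := by
      rw [hdiff]
      refine (Finset.abs_sum_le_sum_abs _ _).trans ((Finset.sum_le_sum hterm).trans ?_)
      rw [Finset.sum_add_distrib, ← Finset.mul_sum, hsum, ← Finset.sum_mul]
      have := mul_le_mul_of_nonneg_right hif (hc0 (n + 1)).le
      linarith
    have hAN : A < ε / 2 * ((n + 1 : ℕ) : ℝ) := by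
      rw [div_lt_iff₀ (by positivity)] at hN
      have : (N : ℝ) ≤ ((n + 1 : ℕ) : ℝ) := by exact_mod_cast hn.trans (Nat.le_succ n)
      nlinarith
    rw [Real.dist_eq, div_sub' hpos.ne', abs_div, abs_of_pos hpos, div_lt_iff₀ hpos, mul_comm _ ρ]
    have := mul_lt_mul_of_pos_right hAN (hc0 (n + 1))
    linarith
  have hone : Tendsto (fun n : ℕ => ((n + 1 : ℕ) : ℝ) / (n : ℝ)) atTop (𝓝 1) := by
    have h := (tendsto_natCast_div_add_atTop (1 : ℝ)).inv₀ one_ne_zero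
    rw [inv_one] at h
    refine h.congr fun n => ?_
    push_cast
    rw [inv_div]
  have h := key.mul hone
  rw [mul_one] at h
  refine h.congr' ?_
  filter_upwards [eventually_gt_atTop 0] with n hn
  have h1 : (n : ℝ) ≠ 0 := by positivity
  have h2 : ((n + 1 : ℕ) : ℝ) ≠ 0 := by positivity
  have h3 := (hc0 (n + 1)).ne'
  field_simp

theorem tendsto_ratio_shift {c : ℕ → ℝ} {ρ : ℝ} (hc0 : ∀ n, 0 < c n)
    (hlim : Tendsto (fun n => c n / c (n + 1)) atTop (𝓝 ρ)) (a : ℕ) :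
    Tendsto (fun n => c (n - a) / c n) atTop (𝓝 (ρ ^ a)) := by
  rw [← tendsto_add_atTop_iff_nat a]
  simp only [Nat.add_sub_cancel]
  induction a with
  | zero =>
    simp only [pow_zero, add_zero]
    exact tendsto_const_nhds.congr fun n => (div_self (hc0 n).ne').symm
  | succ a ih =>
    have h := ih.mul (hlim.comp (tendsto_add_atTop_nat a))
    rw [← pow_succ] at h
    refine h.congr fun n => ?_
    have := (hc0 (n + a)).ne'
    simp only [Function.comp, ← add_assoc]
    field_simp

/-- Convolving a sequence of ratio limit `ρ` with a polynomial `Q` multiplies it asymptotically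
by `Q(ρ)`. -/
theorem tendsto_coeff_mul_div {c : ℕ → ℝ} {ρ : ℝ} (hc0 : ∀ n, 0 < c n)
    (hlim : Tendsto (fun n => c n / c (n + 1)) atTop (𝓝 ρ)) (Q : Polynomial ℝ) :
    Tendsto (fun n => PowerSeries.coeff n ((Q : PowerSeries ℝ) * PowerSeries.mk c) / c n) atTop
      (𝓝 (Q.eval ρ)) := by
  rw [Polynomial.eval_eq_sum_range]
  have h := tendsto_finsetSum (range (Q.natDegree + 1)) fun a _ =>
    (tendsto_ratio_shift hc0 hlim a).const_mul (Q.coeff a)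
  refine h.congr' ?_
  filter_upwards [eventually_ge_atTop Q.natDegree] with n hn
  rw [PowerSeries.coeff_mul, Finset.Nat.sum_antidiagonal_eq_sum_range_succ_mk, Finset.sum_div]
  simp only [Polynomial.coeff_coe, PowerSeries.coeff_mk, mul_div_assoc]
  refine Finset.sum_subset (Finset.range_mono (by omega)) fun a _ ha => ?_
  rw [Polynomial.coeff_eq_zero_of_natDegree_lt (by simpa using ha), zero_mul]

/-- For a sequence with geometric growth, the sum over all divisors is asymptotic to its
largest term. -/
theorem tendsto_sum_divisors_div {u : ℕ → ℝ} {ρ : ℝ} (hρ1 : ρ < 1)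
    (hu : ∀ n, 0 < n → 0 < u n)
    (hlim : Tendsto (fun n => u n / u (n + 1)) atTop (𝓝 ρ)) :
    Tendsto (fun n => (∑ d ∈ n.divisors, u d) / u n) atTop (𝓝 1) := by
  obtain ⟨r, hr, hr1⟩ := exists_between (max_lt hρ1 one_pos)
  obtain ⟨hρr, hr0⟩ := max_lt_iff.1 hr
  obtain ⟨K, hK⟩ := eventually_atTop.1 ((hlim.eventually_lt_const hρr).and (eventually_gt_atTop 0))
  have hK0 : 0 < K := (hK K le_rfl).2
  have hstep : ∀ n, K ≤ n → u n * r ^ n ≤ u (n + 1) * r ^ (n + 1) := by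
    intro n hn
    have h1 := (hK n hn).1
    rw [div_lt_iff₀ (hu _ n.succ_pos)] at h1
    have := mul_le_mul_of_nonneg_right h1.le (pow_pos hr0 n).le
    rw [pow_succ]
    linarith
  have hmono : ∀ d n, K ≤ d → d ≤ n → u d * r ^ d ≤ u n * r ^ n := by
    intro d n hd hdn
    induction n, hdn using Nat.le_induction with
    | base => exact le_rfl
    | succ n hn ih => exact ih.trans (hstep n (hd.trans hn))
  have hwK : 0 < u K * r ^ K := mul_pos (hu K hK0) (pow_pos hr0 K)
  have hratio : ∀ i, 0 ≤ |u i| * r ^ i / (u K * r ^ K) := fun i => by positivity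
  set C : ℝ := 1 + ∑ i ∈ range K, |u i| * r ^ i / (u K * r ^ K) with hC
  have hC1 : 1 ≤ C := le_add_of_nonneg_right (Finset.sum_nonneg fun i _ => hratio i)
  have hbd : ∀ d n, K ≤ n → d ≤ n → u d * r ^ d ≤ C * (u n * r ^ n) := by
    intro d n hn hdn
    have hwn : 0 < u n * r ^ n := hwK.trans_le (hmono K n le_rfl hn)
    rcases le_or_gt K d with hd | hd
    · exact (hmono d n hd hdn).trans (le_mul_of_one_le_left hwn.le hC1)
    · have h1 : |u d| * r ^ d / (u K * r ^ K) ≤ C := by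
        have := Finset.single_le_sum (f := fun i => |u i| * r ^ i / (u K * r ^ K))
          (fun i _ => hratio i) (Finset.mem_range.2 hd)
        linarith
      rw [div_le_iff₀ hwK] at h1
      calc u d * r ^ d ≤ |u d| * r ^ d :=
            mul_le_mul_of_nonneg_right (le_abs_self _) (pow_pos hr0 d).le
        _ ≤ C * (u K * r ^ K) := h1
        _ ≤ C * (u n * r ^ n) :=
            mul_le_mul_of_nonneg_left (hmono K n le_rfl hn) (by linarith)
  set s : ℝ := Real.sqrt r with hs
  have hs0 : 0 < s := Real.sqrt_pos.2 hr0
  have hs1 : s < 1 := by rw [hs, Real.sqrt_lt' one_pos]; simpa using hr1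
  have hsr : s ^ 2 = r := Real.sq_sqrt hr0.le
  have hdec : Tendsto (fun n : ℕ => C * ((n : ℝ) * s ^ n)) atTop (𝓝 0) := by
    simpa using (tendsto_self_mul_const_pow_of_lt_one hs0.le hs1).const_mul C
  have hupper : Tendsto (fun n : ℕ => 1 + C * ((n : ℝ) * s ^ n)) atTop (𝓝 1) := by
    simpa using hdec.const_add 1
  refine tendsto_of_tendsto_of_tendsto_of_le_of_le' tendsto_const_nhds hupper ?_ ?_
  · filter_upwards [eventually_gt_atTop 0] with n hn
    rw [le_div_iff₀ (hu n hn), one_mul]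
    exact Finset.single_le_sum (fun d hd => (hu d (Nat.pos_of_mem_divisors hd)).le)
      (Nat.mem_divisors_self n hn.ne')
  · filter_upwards [eventually_ge_atTop K] with n hn
    have hn0 : 0 < n := hK0.trans_le hn
    have hun := hu n hn0
    rw [div_le_iff₀ hun, ← Nat.insert_self_properDivisors hn0.ne',
      Finset.sum_insert Nat.self_notMem_properDivisors]
    have hterm : ∀ d ∈ n.properDivisors, u d ≤ C * s ^ n * u n := by
      intro d hd
      obtain ⟨hdvd, hlt⟩ := Nat.mem_properDivisors.1 hd
      obtain ⟨e, he⟩ := hdvd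
      have hd2 : 2 * d ≤ n := by
        have : 2 ≤ e := by
          by_contra h
          interval_cases e <;> omega
        rw [he]
        nlinarith
      have h1 := hbd d n hn hlt.le
      have h2 : r ^ n ≤ s ^ n * r ^ d := by
        rw [← hsr, ← pow_mul, ← pow_mul, ← pow_add]
        exact pow_le_pow_of_le_one hs0.le hs1.le (by omega)
      have h3 : u d * r ^ d ≤ (C * s ^ n * u n) * r ^ d := by
        have := mul_le_mul_of_nonneg_left h2 (mul_pos (by linarith : 0 < C) hun).le
        linarith
      exact le_of_mul_le_mul_right h3 (pow_pos hr0 d)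
    have hcard : (n.properDivisors.card : ℝ) ≤ n := by
      have h := Finset.card_le_card
        (fun d hd => Finset.mem_range.2 (Nat.mem_properDivisors.1 hd).2 :
          n.properDivisors ⊆ range n)
      rw [Finset.card_range] at h
      exact_mod_cast h
    have h4 := Finset.sum_le_card_nsmul _ _ _ hterm
    rw [nsmul_eq_mul] at h4
    have h5 := mul_le_mul_of_nonneg_right hcard
      (by positivity : 0 ≤ C * s ^ n * u n)
    linarith

theorem tendsto_ratio_sum_divisors {u : ℕ → ℝ} {ρ : ℝ} (hρ1 : ρ < 1)
    (hu : ∀ n, 0 < n → 0 < u n)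
    (hlim : Tendsto (fun n => u n / u (n + 1)) atTop (𝓝 ρ)) :
    Tendsto (fun n => (∑ d ∈ n.divisors, u d) / ∑ d ∈ (n + 1).divisors, u d) atTop (𝓝 ρ) := by
  have h1 := tendsto_sum_divisors_div hρ1 hu hlim
  have h2 := (h1.comp (tendsto_add_atTop_nat 1)).inv₀ one_ne_zero
  have h := (h1.mul hlim).mul h2
  rw [inv_one, mul_one, one_mul] at h
  refine h.congr' ?_
  filter_upwards [eventually_gt_atTop 0] with n hn
  have h3 := (hu n hn).ne'
  have h4 := (hu (n + 1) n.succ_pos).ne'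
  simp only [Function.comp, inv_div]
  field_simp

theorem Nat.Partition.sum_mul_count_parts {n : ℕ} (P : Nat.Partition n) {s : Finset ℕ}
    (hs : P.parts.toFinset ⊆ s) : ∑ j ∈ s, j * P.parts.count j = n := by
  have h := Finset.sum_multiset_count_of_subset P.parts s hs
  rw [P.parts_sum] at h
  exact (Finset.sum_congr rfl fun j _ => by rw [smul_eq_mul, mul_comm]).trans h.symm

theorem Nat.Partition.toFinset_parts_subset_Icc {n l : ℕ} {P : Nat.Partition n}
    (hP : ∀ j ∈ P.parts, l < j) {N : ℕ} (hN : n ≤ N) : P.parts.toFinset ⊆ Finset.Icc (l + 1) N := fun j hj => by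
  rw [Multiset.mem_toFinset] at hj
  exact Finset.mem_Icc.2 ⟨hP j hj, (P.le_of_mem_parts hj).trans hN⟩

theorem TtilOf_msWt (m : ℕ → ℕ) (p : ℝ) (l n : ℕ) :
    TtilOf (msWt m p) l n = p ^ n * TtilOf (msWt m 1) l n := by
  unfold TtilOf
  rw [Finset.mul_sum]
  refine Finset.sum_congr rfl fun P _ => ?_
  split_ifs with hP
  · simp only [msWt, one_pow, mul_one]
    rw [Finset.prod_mul_distrib, Finset.prod_pow_eq_pow_sum,
      P.sum_mul_count_parts (Nat.Partition.toFinset_parts_subset_Icc hP le_rfl), mul_comm]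
  · rw [mul_zero]

theorem ctilOf_eq_TtilOf (b : ℕ → ℕ → ℝ) (n : ℕ) : ctilOf b n = TtilOf b 0 n := by
  unfold ctilOf TtilOf
  exact Finset.sum_congr rfl fun P _ => (if_pos fun j hj => P.parts_pos hj).symm

theorem TtilOf_msWt_nonneg (m : ℕ → ℕ) (l n : ℕ) : 0 ≤ TtilOf (msWt m 1) l n := by
  unfold TtilOf msWt
  refine Finset.sum_nonneg fun P _ => ?_
  split_ifs
  · exact Finset.prod_nonneg fun j _ => by positivity
  · exact le_rfl

theorem TtilOf_zero_right (b : ℕ → ℕ → ℝ) (l : ℕ) : TtilOf b l 0 = 1 := by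
  unfold TtilOf
  simp

/-- The power series `(1 - X ^ j) ^ (-m j)`. -/
noncomputable def partSeries (m : ℕ → ℕ) (j : ℕ) : PowerSeries ℝ :=
  PowerSeries.mk fun n => if j ∣ n then ((m j + n / j - 1).choose (n / j) : ℝ) else 0

theorem partSeries_eq_expand {m : ℕ → ℕ} {j : ℕ} (hj : j ≠ 0) (hm : 1 ≤ m j) :
    partSeries m j = PowerSeries.expand j hj (PowerSeries.invOneSubPow ℝ (m j)).val := by
  ext n
  rw [partSeries, PowerSeries.coeff_mk, PowerSeries.coeff_expand,
    PowerSeries.invOneSubPow_val_eq_mk_sub_one_add_choose_of_pos _ _ hm, PowerSeries.coeff_mk]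
  rw [Nat.choose_symm_add, Nat.sub_add_comm hm]

theorem one_sub_X_pow_pow_mul_partSeries {m : ℕ → ℕ} {j : ℕ} (hj : j ≠ 0) (hm : 1 ≤ m j) :
    (1 - PowerSeries.X ^ j) ^ m j * partSeries m j = 1 := by
  have h := congrArg (PowerSeries.expand j hj)
    (PowerSeries.invOneSubPow ℝ (m j)).inv_val
  rw [PowerSeries.invOneSubPow_inv_eq_one_sub_pow] at h
  rw [partSeries_eq_expand hj hm]
  simpa using h

/-- The finite Euler product over the parts in `(l, N]`. -/
noncomputable def partProd (m : ℕ → ℕ) (l N : ℕ) : PowerSeries ℝ :=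
  ∏ j ∈ Finset.Icc (l + 1) N, partSeries m j

open scoped PowerSeries.WithPiTopology in
theorem one_add_tsum_eq_partSeries (m : ℕ → ℕ) (i : ℕ) :
    (1 : PowerSeries ℝ) + ∑' k, msWt m 1 (i + 1) (k + 1) • PowerSeries.X ^ ((i + 1) * (k + 1))
      = partSeries m (i + 1) := by
  ext n
  rw [map_add, (Nat.Partition.summable_genFun_term (msWt m 1) i).map_tsum _
    (PowerSeries.WithPiTopology.continuous_coeff _ _)]
  simp only [map_smul, PowerSeries.coeff_X_pow, PowerSeries.coeff_one, smul_eq_mul, mul_ite,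
    mul_one, mul_zero, partSeries, PowerSeries.coeff_mk, msWt, one_pow]
  by_cases hd : i + 1 ∣ n
  · obtain ⟨k, rfl⟩ := hd
    rcases Nat.eq_zero_or_pos k with rfl | hk
    · simp
    · obtain ⟨k, rfl⟩ := Nat.exists_eq_add_one_of_ne_zero hk.ne'
      rw [tsum_eq_single k]
      · simp
      · intro b hb
        rw [if_neg]
        intro h
        have := Nat.eq_of_mul_eq_mul_left i.succ_pos h
        omega
  · have h0 : n ≠ 0 := fun h => hd (h ▸ dvd_zero _)
    rw [if_neg hd, if_neg h0, zero_add]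
    refine (tsum_congr fun k => if_neg ?_).trans tsum_zero
    rintro rfl
    exact hd (dvd_mul_right _ _)

open scoped PowerSeries.WithPiTopology in
theorem genFun_eq_partProd (m : ℕ → ℕ) (l N : ℕ) :
    Nat.Partition.genFun (fun i k => if l < i ∧ i ≤ N then msWt m 1 i k else 0)
      = partProd m l N := by
  have h := Nat.Partition.hasProd_genFun
    (fun i k => if l < i ∧ i ≤ N then msWt m 1 i k else 0)
  refine h.unique ?_
  have hs : partProd m l N = ∏ i ∈ Finset.Ico l N, partSeries m (i + 1) := by
    rw [partProd, Finset.prod_Ico_add' (fun j => partSeries m j) l N 1]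
    rfl
  rw [hs, ← Finset.prod_congr rfl fun i hi => ?_]
  · refine hasProd_prod_of_ne_finset_one fun i hi => ?_
    have : ¬ (l < i + 1 ∧ i + 1 ≤ N) := by
      rw [Finset.mem_Ico] at hi
      omega
    simp only [if_neg this, zero_smul, tsum_zero, add_zero]
  · have : l < i + 1 ∧ i + 1 ≤ N := by
      rw [Finset.mem_Ico] at hi
      omega
    simp only [this, and_self, if_true]
    exact one_add_tsum_eq_partSeries m i

theorem coeff_partProd (m : ℕ → ℕ) (l : ℕ) {n N : ℕ} (hN : n ≤ N) :
    PowerSeries.coeff n (partProd m l N) = TtilOf (msWt m 1) l n := by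
  rw [← genFun_eq_partProd, Nat.Partition.coeff_genFun, TtilOf]
  refine Finset.sum_congr rfl fun P _ => ?_
  rw [Finsupp.prod, Multiset.toFinsupp_support]
  simp only [Multiset.toFinsupp_apply]
  split_ifs with hP
  · have h : ∀ j ∈ P.parts.toFinset, (if l < j ∧ j ≤ N then msWt m 1 j (P.parts.count j) else 0)
        = msWt m 1 j (P.parts.count j) := fun j hj => by
      rw [Multiset.mem_toFinset] at hj
      exact if_pos ⟨hP j hj, (P.le_of_mem_parts hj).trans hN⟩
    rw [Finset.prod_congr rfl h]
    refine Finset.prod_subset (Nat.Partition.toFinset_parts_subset_Icc hP le_rfl) fun j _ hj => ?_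
    rw [Multiset.mem_toFinset] at hj
    simp [msWt, Multiset.count_eq_zero_of_notMem hj]
  · push Not at hP
    obtain ⟨j, hj, hjl⟩ := hP
    refine Finset.prod_eq_zero (Multiset.mem_toFinset.2 hj) (if_neg ?_)
    omega

theorem poly_mul_partProd {m : ℕ → ℕ} (hm : ∀ j, 1 ≤ m j) {l N : ℕ} (hN : l ≤ N) :
    (∏ j ∈ Finset.Icc 1 l, (1 - PowerSeries.X ^ j) ^ m j) * partProd m 0 N = partProd m l N := by
  have h : partProd m 0 N = (∏ j ∈ Finset.Icc 1 l, partSeries m j) * partProd m l N := by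
    simp only [partProd, zero_add]
    have h1 := Finset.prod_Ioc_consecutive (partSeries m) (Nat.zero_le l) hN
    simp only [← Finset.Icc_add_one_left_eq_Ioc, zero_add] at h1
    exact h1.symm
  rw [h, ← mul_assoc, ← Finset.prod_mul_distrib, Finset.prod_congr rfl fun j hj => ?_,
    Finset.prod_const_one, one_mul]
  exact one_sub_X_pow_pow_mul_partSeries (by rw [Finset.mem_Icc] at hj; omega) (hm j)

theorem mk_TtilOf_eq_mul {m : ℕ → ℕ} (hm : ∀ j, 1 ≤ m j) (l : ℕ) :
    PowerSeries.mk (TtilOf (msWt m 1) l) =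
      (∏ j ∈ Finset.Icc 1 l, (1 - PowerSeries.X ^ j) ^ m j)
        * PowerSeries.mk (TtilOf (msWt m 1) 0) := by
  ext n
  rw [PowerSeries.coeff_mk, ← coeff_partProd m l (le_max_left n l),
    ← poly_mul_partProd hm (le_max_right n l), PowerSeries.coeff_mul, PowerSeries.coeff_mul]
  refine Finset.sum_congr rfl fun x hx => ?_
  rw [PowerSeries.coeff_mk, coeff_partProd]
  have := Finset.HasAntidiagonal.mem_antidiagonal.1 hx
  omega

/-- `X` times the logarithmic derivative of `partSeries m j`. -/
noncomputable def logDerivSeries (m : ℕ → ℕ) (j : ℕ) : PowerSeries ℝ :=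
  PowerSeries.mk fun n => if j ∣ n ∧ n ≠ 0 then (j : ℝ) * m j else 0

theorem logDerivSeries_mul (m : ℕ → ℕ) {j : ℕ} (hj : j ≠ 0) :
    logDerivSeries m j * (1 - PowerSeries.X ^ j) =
      PowerSeries.C ((j : ℝ) * m j) * PowerSeries.X ^ j := by
  ext n
  rw [mul_sub, mul_one, map_sub, PowerSeries.coeff_mul_X_pow', PowerSeries.coeff_C_mul_X_pow]
  simp only [logDerivSeries, PowerSeries.coeff_mk]
  rcases lt_trichotomy n j with h | rfl | h
  · have : ¬ (j ∣ n ∧ n ≠ 0) := fun h1 => h1.2 (Nat.eq_zero_of_dvd_of_lt h1.1 h)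
    rw [if_neg this, if_neg (by omega), if_neg (by omega), sub_zero]
  · simp [hj]
  · have h1 : (j ∣ n - j) ↔ j ∣ n := (Nat.dvd_sub_iff_left h.le dvd_rfl)
    have h2 : n - j ≠ 0 := by omega
    have h3 : n ≠ 0 := by omega
    simp [h1, h2, h3, h.le, h.ne']

theorem X_mul_derivative_partSeries {m : ℕ → ℕ} {j : ℕ} (hj : j ≠ 0) (hm : 1 ≤ m j) :
    PowerSeries.X * PowerSeries.derivative ℝ (partSeries m j)
      = partSeries m j * logDerivSeries m j := by
  have h := one_sub_X_pow_pow_mul_partSeries hj hm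
  have hl := logDerivSeries_mul m hj
  have hd := congrArg (PowerSeries.derivative ℝ) h
  obtain ⟨a, ha⟩ := Nat.exists_eq_add_of_le' hm
  obtain ⟨i, rfl⟩ := Nat.exists_eq_add_one_of_ne_zero hj
  set B := partSeries m (i + 1)
  set D := logDerivSeries m (i + 1)
  rw [ha] at h hd hl
  rw [Derivation.leibniz, PowerSeries.derivative_pow, map_sub, PowerSeries.derivative_pow,
    PowerSeries.derivative_one, PowerSeries.derivative_X] at hd
  simp only [smul_eq_mul, Nat.add_sub_cancel, map_mul, map_natCast, zero_sub, mul_one] at hd hl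
  have hx : (1 - PowerSeries.X ^ (i + 1) : PowerSeries ℝ) ^ (a + 1) ≠ 0 :=
    left_ne_zero_of_mul_eq_one h
  refine mul_left_cancel₀ hx ?_
  linear_combination PowerSeries.X * hd - (1 - PowerSeries.X ^ (i + 1)) ^ a * B * hl

theorem X_mul_derivative_partProd {m : ℕ → ℕ} (hm : ∀ j, 1 ≤ m j) (l N : ℕ) :
    PowerSeries.X * PowerSeries.derivative ℝ (partProd m l N)
      = partProd m l N * ∑ j ∈ Finset.Icc (l + 1) N, logDerivSeries m j := by
  have key : ∀ s : Finset ℕ, 0 ∉ s → PowerSeries.X * PowerSeries.derivative ℝ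
      (∏ j ∈ s, partSeries m j) = (∏ j ∈ s, partSeries m j) * ∑ j ∈ s, logDerivSeries m j := by
    intro s
    induction s using Finset.induction_on with
    | empty => simp
    | insert j s hjs ih =>
      intro h0
      rw [Finset.mem_insert, not_or] at h0
      have h1 := X_mul_derivative_partSeries (Ne.symm h0.1) (hm j)
      have h2 := ih h0.2
      rw [Finset.prod_insert hjs, Finset.sum_insert hjs, Derivation.leibniz, smul_eq_mul,
        smul_eq_mul]
      linear_combination (∏ j ∈ s, partSeries m j) * h1 + partSeries m j * h2
  exact key _ (by simp)

theorem coeff_sum_logDerivSeries (m : ℕ → ℕ) {n N : ℕ} (hN : n ≤ N) :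
    PowerSeries.coeff n (∑ j ∈ Finset.Icc 1 N, logDerivSeries m j)
      = ∑ d ∈ n.divisors, (d : ℝ) * m d := by
  rw [map_sum]
  simp only [logDerivSeries, PowerSeries.coeff_mk]
  rw [← Finset.sum_filter]
  refine Finset.sum_congr ?_ fun _ _ => rfl
  ext d
  simp only [Finset.mem_filter, Finset.mem_Icc, Nat.mem_divisors]
  refine ⟨fun h => h.2, fun h => ⟨⟨Nat.pos_of_dvd_of_pos h.1 (Nat.pos_of_ne_zero h.2), ?_⟩, h⟩⟩
  exact (Nat.le_of_dvd (Nat.pos_of_ne_zero h.2) h.1).trans hN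

theorem mul_TtilOf_zero_eq_sum {m : ℕ → ℕ} (hm : ∀ j, 1 ≤ m j) (n : ℕ) :
    (n : ℝ) * TtilOf (msWt m 1) 0 n = ∑ k ∈ range (n + 1),
      (∑ d ∈ k.divisors, (d : ℝ) * m d) * TtilOf (msWt m 1) 0 (n - k) := by
  have h := congrArg (PowerSeries.coeff n) (X_mul_derivative_partProd hm 0 n)
  rw [mul_comm (partProd m 0 n), PowerSeries.coeff_mul (φ := Finset.sum _ _),
    Finset.Nat.sum_antidiagonal_eq_sum_range_succ_mk] at h
  have hl : PowerSeries.coeff n (PowerSeries.X * PowerSeries.derivative ℝ (partProd m 0 n))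
      = n * TtilOf (msWt m 1) 0 n := by
    rw [← coeff_partProd m 0 le_rfl]
    rcases n with _ | n
    · simp
    · rw [PowerSeries.coeff_succ_X_mul, PowerSeries.coeff_derivative]
      push_cast
      ring
  refine hl.symm.trans (h.trans ?_)
  refine Finset.sum_congr rfl fun k hk => ?_
  rw [zero_add, coeff_sum_logDerivSeries m (Nat.lt_succ_iff.1 (Finset.mem_range.1 hk)),
    coeff_partProd m 0 (Nat.sub_le n k)]

theorem TtilOf_zero_monotone {m : ℕ → ℕ} (hm : ∀ j, 1 ≤ m j) :
    Monotone (TtilOf (msWt m 1) 0) := by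
  have hcoef : ∀ n, TtilOf (msWt m 1) 0 n = ∑ x ∈ Finset.HasAntidiagonal.antidiagonal n,
      ((m 1 + x.1 - 1).choose x.1 : ℝ) * TtilOf (msWt m 1) 1 x.2 := by
    intro n
    have h := mk_TtilOf_eq_mul hm 1
    rw [Finset.Icc_self, Finset.prod_singleton] at h
    have h2 : PowerSeries.mk (TtilOf (msWt m 1) 0)
        = partSeries m 1 * PowerSeries.mk (TtilOf (msWt m 1) 1) := by
      rw [h, ← mul_assoc, mul_comm (partSeries m 1),
        one_sub_X_pow_pow_mul_partSeries one_ne_zero (hm 1), one_mul]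
    have h3 := congrArg (PowerSeries.coeff n) h2
    rw [PowerSeries.coeff_mul, PowerSeries.coeff_mk] at h3
    simpa [partSeries] using h3
  refine monotone_nat_of_le_succ fun n => ?_
  rw [hcoef, hcoef, Finset.Nat.sum_antidiagonal_succ]
  refine le_add_of_nonneg_of_le (mul_nonneg (by positivity) (TtilOf_msWt_nonneg _ _ _)) ?_
  refine Finset.sum_le_sum fun x _ => mul_le_mul_of_nonneg_right ?_ (TtilOf_msWt_nonneg _ _ _)
  obtain ⟨a, ha⟩ := Nat.exists_eq_add_of_le' (hm 1)
  rw [ha, show a + 1 + x.1 - 1 = a + x.1 by omega,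
    show a + 1 + (x.1 + 1) - 1 = a + x.1 + 1 by omega, Nat.choose_succ_succ]
  exact_mod_cast Nat.le_add_right _ _

/-- **Multisets with geometrically decaying ratios converge.** If
`ã_k^{(j)} = C(m_j+k−1,k) p^{jk}` with `m_j ≥ 1` integers satisfying `m_j/m_{j+1} → ρ₀`
for some `ρ₀ ∈ (0,1)`, and `0 < p < 1`, then `(c̃_n) ∈ RT_{ρ₀/p}` and for every `l ≥ 1`
and every `(k_1,…,k_l) ∈ ℕ^l`,
`lim P_n(k_1,…,k_l) = ∏_{j=1}^l C(m_j+k_j−1,k_j) ρ₀^{j k_j}(1−ρ₀^j)^{m_j}`: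
this multiset is convergent with independent negative-binomial limit laws. -/
theorem stmt19 (m : ℕ → ℕ) (hm : ∀ j, 1 ≤ m j)
    (ρ₀ : ℝ) (hρ₀0 : 0 < ρ₀) (hρ₀1 : ρ₀ < 1)
    (hsm : Tendsto (fun j => (m j : ℝ) / (m (j + 1) : ℝ)) atTop (nhds ρ₀))
    (p : ℝ) (hp0 : 0 < p) (hp1 : p < 1) :
    RT (ctilOf (msWt m p)) (ρ₀ / p) ∧
    ∀ l, 1 ≤ l → ∀ k : Fin l → ℕ,
      Tendsto (fun n => PformOf (msWt m p) l k n) atTop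
        (nhds (∏ i : Fin l,
          (Nat.choose (m ((i : ℕ) + 1) + k i - 1) (k i) : ℝ)
            * ρ₀ ^ (((i : ℕ) + 1) * k i)
            * (1 - ρ₀ ^ ((i : ℕ) + 1)) ^ (m ((i : ℕ) + 1)))) := by
  set c : ℕ → ℝ := TtilOf (msWt m 1) 0 with hc
  have hmono : Monotone c := TtilOf_zero_monotone hm
  have hpos : ∀ n, 0 < c n := fun n =>
    one_pos.trans_le ((TtilOf_zero_right (msWt m 1) 0).symm.le.trans (hmono n.zero_le))
  have hmpos : ∀ j, (0 : ℝ) < m j := fun j => by exact_mod_cast hm j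
  have hu : ∀ n : ℕ, 0 < n → 0 < (n : ℝ) * m n := fun n hn =>
    mul_pos (by exact_mod_cast hn) (hmpos n)
  have hulim : Tendsto (fun n : ℕ => ((n : ℝ) * m n) / (((n + 1 : ℕ) : ℝ) * m (n + 1)))
      atTop (𝓝 ρ₀) := by
    have h := (tendsto_natCast_div_add_atTop (1 : ℝ)).mul hsm
    rw [one_mul] at h
    refine h.congr fun n => ?_
    push_cast
    rw [div_mul_div_comm]
  have hratio : Tendsto (fun n => c n / c (n + 1)) atTop (𝓝 ρ₀) :=
    tendsto_ratio_of_convolution (g := fun k => ∑ d ∈ k.divisors, (d : ℝ) * m d) hpos hmono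
      (by simp) (fun n hn => Finset.sum_pos (fun d hd => hu d (Nat.pos_of_mem_divisors hd))
        (Nat.nonempty_divisors.2 hn.ne'))
      (tendsto_ratio_sum_divisors (u := fun d : ℕ => (d : ℝ) * m d) hρ₀1 hu hulim)
      (mul_TtilOf_zero_eq_sum hm)
  have hctil : ∀ n, ctilOf (msWt m p) n = p ^ n * c n := fun n => by
    rw [ctilOf_eq_TtilOf, TtilOf_msWt]
  refine ⟨?_, fun l _ k => ?_⟩
  · refine (hratio.div_const p).congr fun n => ?_
    have := (hpos (n + 1)).ne'
    have hp := hp0.ne'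
    rw [hctil, hctil, pow_succ]
    field_simp
  · set Q : Polynomial ℝ := ∏ j ∈ Finset.Icc 1 l, (1 - Polynomial.X ^ j) ^ m j with hQ
    set M : ℕ := ∑ i : Fin l, ((i : ℕ) + 1) * k i with hM
    have hT : ∀ n, TtilOf (msWt m 1) l n
        = PowerSeries.coeff n ((Q : PowerSeries ℝ) * PowerSeries.mk c) := fun n => by
      have h := congrArg (PowerSeries.coeff n) (mk_TtilOf_eq_mul hm l)
      rw [PowerSeries.coeff_mk] at h
      have hQc : (Q : PowerSeries ℝ)
          = ∏ j ∈ Finset.Icc 1 l, (1 - PowerSeries.X ^ j) ^ m j := by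
        rw [hQ, ← Polynomial.coeToPowerSeries.ringHom_apply, map_prod]
        simp
      rw [h, hQc]
    have hlim := ((tendsto_coeff_mul_div hpos hratio Q).comp (tendsto_sub_atTop_nat M)).mul
      (tendsto_ratio_shift hpos hratio M)
    have hlim' := hlim.const_mul
      (∏ i : Fin l, (Nat.choose (m ((i : ℕ) + 1) + k i - 1) (k i) : ℝ))
    have hval : (∏ i : Fin l, (Nat.choose (m ((i : ℕ) + 1) + k i - 1) (k i) : ℝ))
        * (Q.eval ρ₀ * ρ₀ ^ M) = ∏ i : Fin l,
          (Nat.choose (m ((i : ℕ) + 1) + k i - 1) (k i) : ℝ)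
            * ρ₀ ^ (((i : ℕ) + 1) * k i)
            * (1 - ρ₀ ^ ((i : ℕ) + 1)) ^ (m ((i : ℕ) + 1)) := by
      have hQe : Q.eval ρ₀ = ∏ i : Fin l, (1 - ρ₀ ^ ((i : ℕ) + 1)) ^ m ((i : ℕ) + 1) := by
        rw [Fin.prod_univ_eq_prod_range (fun i => (1 - ρ₀ ^ (i + 1)) ^ m (i + 1)) l,
          Finset.range_eq_Ico, Finset.prod_Ico_add' (fun j => (1 - ρ₀ ^ j) ^ m j) 0 l 1, hQ,
          Polynomial.eval_prod]
        simp only [Polynomial.eval_pow, Polynomial.eval_sub, Polynomial.eval_one,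
          Polynomial.eval_X]
        rfl
      rw [hQe, hM, ← Finset.prod_pow_eq_pow_sum, Finset.prod_mul_distrib,
        Finset.prod_mul_distrib]
      ring
    rw [hval] at hlim'
    refine hlim'.congr' ?_
    filter_upwards [eventually_ge_atTop M] with n hn
    have h1 := (hpos n).ne'
    have h2 := (hpos (n - M)).ne'
    have h3 := (pow_pos hp0 n).ne'
    have hprod : ∏ i : Fin l, msWt m p ((i : ℕ) + 1) (k i)
        = (∏ i : Fin l, (Nat.choose (m ((i : ℕ) + 1) + k i - 1) (k i) : ℝ)) * p ^ M := by
      simp only [msWt]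
      rw [Finset.prod_mul_distrib, Finset.prod_pow_eq_pow_sum]
    have hpow : p ^ M * p ^ (n - M) = p ^ n := by rw [← pow_add, Nat.add_sub_cancel' hn]
    rw [PformOf, hprod, TtilOf_msWt, hT, hctil, ← hM, mul_assoc, ← mul_assoc (p ^ M), hpow]
    simp only [Function.comp]
    field_simp
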